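/- arXiv:2201.02774 — 2 statements merged into one kernel-verified Lean document; each statement's English description precedes it below -/
import Mathlib

section
/- Let P_tot > 0, m ≥ 100, 0 ≤ q ≤ 9.9, θ > 0, ε ∈ (0, 1/2], n ≥ 1, probabilities p₁, …, p_n > 0 with Σ p_j = 1, and channel-state gains H_{A,j}, H_{B,j} > 0 for j = 1, …, n, with associated HD SNR functions f_j(x) = H_{A,j}·H_{B,j}·x·(P_tot − x)/(H_{A,j}·(P_tot + x) + H_{B,j}·(P_tot − x) + 2). Then the set I = {x ∈ (0, P_tot) : f_j(x) > 1 for all j} is an interval, and the expected effective capacity Φ(x) = −(1/(mθ))·log(Σ_{j=1}^n p_j·(e^{−r_{m,q}(f_j(x))·m·θ/2}·(1 − ε) + ε)) is concave on I. -/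
noncomputable def rFBL (m q γ : ℝ) : ℝ :=
  Real.logb 2 (1 + γ)
    - (Real.sqrt (γ * (γ + 2)) / ((γ + 1) * Real.sqrt m)) * q * Real.logb 2 (Real.exp 1)
    + Real.logb 2 m / m

noncomputable def fHD (HA HB Ptot x : ℝ) : ℝ :=
  HA * HB * x * (Ptot - x) / (HA * (Ptot + x) + HB * (Ptot - x) + 2)

/-- Two-term Hölder inequality for weights `a + b = 1`. -/
theorem rpow_mul_rpow_add_le {a b A B C D : ℝ} (ha : 0 ≤ a) (hb : 0 ≤ b) (hab : a + b = 1)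
    (hA : 0 < A) (hB : 0 < B) (hC : 0 < C) (hD : 0 < D) :
    A ^ a * B ^ b + C ^ a * D ^ b ≤ (A + C) ^ a * (B + D) ^ b := by
  have h₁ := Real.geom_mean_le_arith_mean2_weighted ha hb
    (div_pos hA (add_pos hA hC)).le (div_pos hB (add_pos hB hD)).le hab
  have h₂ := Real.geom_mean_le_arith_mean2_weighted ha hb
    (div_pos hC (add_pos hA hC)).le (div_pos hD (add_pos hB hD)).le hab
  rw [Real.div_rpow hA.le (add_pos hA hC).le, Real.div_rpow hB.le (add_pos hB hD).le,
    div_mul_div_comm] at h₁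
  rw [Real.div_rpow hC.le (add_pos hA hC).le, Real.div_rpow hD.le (add_pos hB hD).le,
    div_mul_div_comm] at h₂
  have hpos : 0 < (A + C) ^ a * (B + D) ^ b := by positivity
  have hone : a * (A / (A + C)) + b * (B / (B + D)) + (a * (C / (A + C)) + b * (D / (B + D)))
      = 1 := by
    have h₃ : A + C ≠ 0 := by positivity
    have h₄ : B + D ≠ 0 := by positivity
    field_simp
    linear_combination (A + C) * (B + D) * hab
  rw [← div_le_one hpos, add_div]
  linarith

theorem ConvexOn.log_add {s : Set ℝ} {f g : ℝ → ℝ} (hf : ConvexOn ℝ s fun x => Real.log (f x))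
    (hg : ConvexOn ℝ s fun x => Real.log (g x)) (hf₀ : ∀ x, 0 < f x) (hg₀ : ∀ x, 0 < g x) :
    ConvexOn ℝ s fun x => Real.log (f x + g x) := by
  refine ⟨hf.1, fun x hx y hy a b ha hb hab => ?_⟩
  have key : ∀ {h : ℝ → ℝ}, (ConvexOn ℝ s fun x => Real.log (h x)) → (∀ x, 0 < h x) →
      h (a • x + b • y) ≤ h x ^ a * h y ^ b := by
    intro h hh h₀
    have := hh.2 hx hy ha hb hab
    rw [← Real.log_le_log_iff (h₀ _) (by have := h₀ x; have := h₀ y; positivity),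
      Real.log_mul (Real.rpow_pos_of_pos (h₀ _) _).ne' (Real.rpow_pos_of_pos (h₀ _) _).ne',
      Real.log_rpow (h₀ _), Real.log_rpow (h₀ _)]
    simpa using this
  have hx₀ := add_pos (hf₀ x) (hg₀ x)
  have hy₀ := add_pos (hf₀ y) (hg₀ y)
  have hle := (add_le_add (key hf hf₀) (key hg hg₀)).trans
    (rpow_mul_rpow_add_le ha hb hab (hf₀ x) (hf₀ y) (hg₀ x) (hg₀ y))
  have := Real.log_le_log (add_pos (hf₀ _) (hg₀ _)) hle
  rw [Real.log_mul (Real.rpow_pos_of_pos hx₀ _).ne' (Real.rpow_pos_of_pos hy₀ _).ne',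
    Real.log_rpow hx₀, Real.log_rpow hy₀] at this
  simpa using this

theorem ConvexOn.log_sum {ι : Type*} {s : Set ℝ} {t : Finset ι} (ht : t.Nonempty)
    {f : ι → ℝ → ℝ} (hf : ∀ i, ConvexOn ℝ s fun x => Real.log (f i x))
    (hf₀ : ∀ i x, 0 < f i x) : ConvexOn ℝ s fun x => Real.log (∑ i ∈ t, f i x) := by
  induction ht using Finset.Nonempty.cons_induction with
  | singleton i => simpa using hf i
  | cons i t hi ht ih =>
    simp only [Finset.sum_cons]
    exact (hf i).log_add ih (hf₀ i) fun x => Finset.sum_pos (fun j _ => hf₀ j x) ht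

theorem concaveOn_fHD {HA HB P : ℝ} (hA : 0 < HA) (hB : 0 < HB) (hP : 0 < P) :
    ConcaveOn ℝ (Set.Ioo 0 P) (fHD HA HB P) := by
  have hD : ∀ x ∈ Set.Ioo 0 P, 0 < HA * (P + x) + HB * (P - x) + 2 := by
    rintro x ⟨h₀, h₁⟩
    have := sub_pos.2 h₁
    positivity
  refine ⟨convex_Ioo 0 P, fun x hx y hy a b ha hb hab => ?_⟩
  have hz := hD _ (convex_Ioo 0 P hx hy ha hb hab)
  have hx := hD x hx
  have hy := hD y hy
  obtain rfl : b = 1 - a := by linarith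
  simp only [smul_eq_mul] at *
  rw [← sub_nonneg]
  have : fHD HA HB P (a * x + (1 - a) * y) - (a * fHD HA HB P x + (1 - a) * fHD HA HB P y)
      = HA * HB * a * (1 - a) * (x - y) ^ 2 * ((HA * P + HB * P + 2) * (2 * HA * P + 2)) /
        ((HA * (P + x) + HB * (P - x) + 2) * (HA * (P + y) + HB * (P - y) + 2) *
          (HA * (P + (a * x + (1 - a) * y)) + HB * (P - (a * x + (1 - a) * y)) + 2)) := by
    unfold fHD
    field_simp
    ring
  rw [this]
  positivity

/-- Derivative of the channel-dispersion term `√(t² - 1) / t`, where `t = 1 + γ`. -/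
theorem hasDerivAt_sqrt_sq_sub_one_div {t : ℝ} (ht : 1 < t) :
    HasDerivAt (fun t : ℝ => √(t ^ 2 - 1) / t) (t ^ 2 * √(t ^ 2 - 1))⁻¹ t := by
  have h₀ : 0 < t ^ 2 - 1 := by nlinarith
  have hw : 0 < √(t ^ 2 - 1) := Real.sqrt_pos.2 h₀
  have hsq := Real.sq_sqrt h₀.le
  have := (((hasDerivAt_pow 2 t).sub_const 1).sqrt h₀.ne').div (hasDerivAt_id t) (by positivity)
  refine this.congr_deriv ?_
  simp only [id]
  field_simp
  push_cast
  rw [hsq]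
  ring

theorem hasDerivAt_log_sub_dispersion (c : ℝ) {t : ℝ} (ht : 1 < t) :
    HasDerivAt (fun t : ℝ => Real.log t - c * (√(t ^ 2 - 1) / t))
      (t⁻¹ - c * (t ^ 2 * √(t ^ 2 - 1))⁻¹) t :=
  (Real.hasDerivAt_log (by positivity)).sub ((hasDerivAt_sqrt_sq_sub_one_div ht).const_mul c)

theorem hasDerivAt_inv_sq_mul_sqrt {t : ℝ} (ht : 1 < t) :
    HasDerivAt (fun t : ℝ => (t ^ 2 * √(t ^ 2 - 1))⁻¹)
      (-(2 * √(t ^ 2 - 1) ^ 2 + t ^ 2) / (t ^ 3 * √(t ^ 2 - 1) ^ 3)) t := by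
  have h₀ : 0 < t ^ 2 - 1 := by nlinarith
  have hw : 0 < √(t ^ 2 - 1) := Real.sqrt_pos.2 h₀
  have := ((hasDerivAt_pow 2 t).mul (((hasDerivAt_pow 2 t).sub_const 1).sqrt h₀.ne')).inv
    (by simp only [Pi.mul_apply]; positivity)
  refine this.congr_deriv ?_
  simp only [Pi.mul_apply]
  field_simp
  push_cast
  ring

theorem sqrt_sq_sub_one_gt {t : ℝ} (ht : 2 < t) : 17 / 10 < √(t ^ 2 - 1) :=
  Real.lt_sqrt_of_sq_lt (by nlinarith)

theorem concaveOn_log_sub_dispersion {c : ℝ} (hc₀ : 0 ≤ c) (hc₁ : c ≤ 1) :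
    ConcaveOn ℝ (Set.Ioi 2) fun t : ℝ => Real.log t - c * (√(t ^ 2 - 1) / t) := by
  refine concaveOn_of_hasDerivWithinAt2_nonpos (f'' := fun t => -(t ^ 2)⁻¹ -
      c * (-(2 * √(t ^ 2 - 1) ^ 2 + t ^ 2) / (t ^ 3 * √(t ^ 2 - 1) ^ 3))) (convex_Ioi 2)
    (fun t ht => (hasDerivAt_log_sub_dispersion c (lt_trans one_lt_two ht)).continuousAt.continuousWithinAt)
    (fun t ht => (hasDerivAt_log_sub_dispersion c
      (lt_trans one_lt_two (interior_subset ht))).hasDerivWithinAt)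
    (fun t ht => ?_) (fun t ht => ?_)
  · have ht : 2 < t := interior_subset ht
    exact ((hasDerivAt_inv (by positivity)).sub
      ((hasDerivAt_inv_sq_mul_sqrt (by linarith)).const_mul c)).hasDerivWithinAt
  · have ht : 2 < t := interior_subset ht
    have hw := sqrt_sq_sub_one_gt ht
    have hsq := Real.sq_sqrt (show 0 ≤ t ^ 2 - 1 by nlinarith)
    set w := √(t ^ 2 - 1)
    have hpoly : c * (2 * w ^ 2 + t ^ 2) ≤ t * w ^ 3 := by
      have h₁ : c * (2 * w ^ 2 + t ^ 2) ≤ 1 * (2 * w ^ 2 + t ^ 2) := by gcongr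
      have h₂ : 2 * (17 / 10 * w ^ 2) ≤ t * (w * w ^ 2) := by gcongr
      nlinarith
    have : -(t ^ 2)⁻¹ - c * (-(2 * w ^ 2 + t ^ 2) / (t ^ 3 * w ^ 3))
        = (c * (2 * w ^ 2 + t ^ 2) - t * w ^ 3) / (t ^ 3 * w ^ 3) := by
      field_simp
      ring
    rw [this]
    exact div_nonpos_of_nonpos_of_nonneg (by linarith) (by positivity)

theorem monotoneOn_log_sub_dispersion {c : ℝ} (hc₁ : c ≤ 1) :
    MonotoneOn (fun t : ℝ => Real.log t - c * (√(t ^ 2 - 1) / t)) (Set.Ioi 2) := by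
  refine monotoneOn_of_hasDerivWithinAt_nonneg (convex_Ioi 2)
    (fun t ht => (hasDerivAt_log_sub_dispersion c (lt_trans one_lt_two ht)).continuousAt.continuousWithinAt)
    (fun t ht => (hasDerivAt_log_sub_dispersion c
      (lt_trans one_lt_two (interior_subset ht))).hasDerivWithinAt) (fun t ht => ?_)
  have ht : 2 < t := interior_subset ht
  have hw := sqrt_sq_sub_one_gt ht
  set w := √(t ^ 2 - 1)
  have : t⁻¹ - c * (t ^ 2 * w)⁻¹ = (t * w - c) / (t ^ 2 * w) := by
    field_simp
  rw [this]
  exact div_nonneg (by nlinarith) (by positivity)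

theorem rFBL_eq (m q γ : ℝ) :
    rFBL m q γ = (Real.log (γ + 1) - q / √m * (√((γ + 1) ^ 2 - 1) / (γ + 1))) / Real.log 2
      + Real.logb 2 m / m := by
  have : γ * (γ + 2) = (γ + 1) ^ 2 - 1 := by ring
  rw [rFBL, this, Real.logb, Real.logb, Real.log_exp, add_comm 1 γ, div_mul_eq_div_div]
  ring

theorem concaveOn_rFBL {m q : ℝ} (hq : 0 ≤ q) (hqm : q ≤ √m) :
    ConcaveOn ℝ (Set.Ioi 1) (rFBL m q) := by
  have h := concaveOn_log_sub_dispersion (c := q / √m) (by positivity)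
    (div_le_one_of_le₀ hqm (Real.sqrt_nonneg m))
  refine ⟨convex_Ioi 1, fun x (hx : 1 < x) y (hy : 1 < y) a b ha hb hab => ?_⟩
  have key := h.2 (x := x + 1) (y := y + 1) (by simp only [Set.mem_Ioi]; linarith)
    (by simp only [Set.mem_Ioi]; linarith) ha hb hab
  simp only [smul_eq_mul] at key ⊢
  have hz : a * (x + 1) + b * (y + 1) = a * x + b * y + 1 := by linear_combination hab
  rw [hz] at key
  have := div_le_div_of_nonneg_right key (Real.log_nonneg one_le_two)
  simp only [rFBL_eq]
  linear_combination this + Real.logb 2 m / m * hab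

theorem monotoneOn_rFBL {m q : ℝ} (hqm : q ≤ √m) : MonotoneOn (rFBL m q) (Set.Ioi 1) := by
  intro x (hx : 1 < x) y (hy : 1 < y) hxy
  have := monotoneOn_log_sub_dispersion (div_le_one_of_le₀ hqm (Real.sqrt_nonneg m))
    (a := x + 1) (b := y + 1) (by simp only [Set.mem_Ioi]; linarith)
    (by simp only [Set.mem_Ioi]; linarith) (by linarith)
  simp only [rFBL_eq]
  gcongr

theorem stmt_12 (Ptot m q θ ε : ℝ) (hP : 0 < Ptot) (hm : 100 ≤ m)
    (hq0 : 0 ≤ q) (hq1 : q ≤ 9.9) (hθ : 0 < θ) (hε0 : 0 < ε) (hε1 : ε ≤ 1 / 2)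
    (n : ℕ) (hn : 1 ≤ n) (p : Fin n → ℝ) (hp : ∀ j, 0 < p j) (hsum : ∑ j, p j = 1)
    (HA HB : Fin n → ℝ) (hHA : ∀ j, 0 < HA j) (hHB : ∀ j, 0 < HB j) :
    Convex ℝ {x : ℝ | x ∈ Set.Ioo (0 : ℝ) Ptot ∧ ∀ j, 1 < fHD (HA j) (HB j) Ptot x} ∧
    ConcaveOn ℝ {x : ℝ | x ∈ Set.Ioo (0 : ℝ) Ptot ∧ ∀ j, 1 < fHD (HA j) (HB j) Ptot x}
      (fun x =>
        -(1 / (m * θ)) *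
          Real.log (∑ j, p j *
            (Real.exp (-(rFBL m q (fHD (HA j) (HB j) Ptot x) * m * θ / 2)) * (1 - ε) + ε))) := by
  have hf := fun j => concaveOn_fHD (hHA j) (hHB j) hP
  set I := {x : ℝ | x ∈ Set.Ioo (0 : ℝ) Ptot ∧ ∀ j, 1 < fHD (HA j) (HB j) Ptot x}
  have hI : Convex ℝ I := fun x hx y hy a b ha hb hab =>
    ⟨convex_Ioo 0 Ptot hx.1 hy.1 ha hb hab, fun j =>
      ((hf j).convex_gt 1 ⟨hx.1, hx.2 j⟩ ⟨hy.1, hy.2 j⟩ ha hb hab).2⟩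
  refine ⟨hI, ?_⟩
  have hm₀ : 0 < m := by linarith
  have hε : 0 < 1 - ε := by linarith
  have hqm : q ≤ √m := Real.le_sqrt_of_sq_le (by nlinarith)
  have hr : ∀ j, ConcaveOn ℝ I fun x => rFBL m q (fHD (HA j) (HB j) Ptot x) := by
    refine fun j => ⟨hI, fun x hx y hy a b ha hb hab => ?_⟩
    refine ((concaveOn_rFBL hq0 hqm).2 (hx.2 j) (hy.2 j) ha hb hab).trans ?_
    exact monotoneOn_rFBL hqm (convex_Ioi 1 (hx.2 j) (hy.2 j) ha hb hab)
      ((hI hx hy ha hb hab).2 j) ((hf j).2 hx.1 hy.1 ha hb hab)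
  have hlog : ∀ j, ConvexOn ℝ I fun x => Real.log (p j *
      (Real.exp (-(rFBL m q (fHD (HA j) (HB j) Ptot x) * m * θ / 2)) * (1 - ε) + ε)) := by
    intro j
    have hexp : ConvexOn ℝ I fun x => Real.log
        (Real.exp (-(rFBL m q (fHD (HA j) (HB j) Ptot x) * m * θ / 2)) * (1 - ε)) := by
      have h := ((hr j).smul (show 0 ≤ m * θ / 2 by positivity)).neg.add_const
        (Real.log (1 - ε))
      refine h.congr fun x _ => ?_
      rw [Real.log_mul (Real.exp_ne_zero _) hε.ne', Real.log_exp]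
      simp only [Pi.add_apply, Pi.neg_apply, smul_eq_mul]
      ring
    have h := (hexp.log_add (convexOn_const (Real.log ε) hI) (fun x => by positivity)
      fun _ => hε0).add_const (Real.log (p j))
    refine h.congr fun x _ => ?_
    rw [Real.log_mul (hp j).ne' (by positivity)]
    simp only [Pi.add_apply]
    ring
  have hne : (Finset.univ : Finset (Fin n)).Nonempty := ⟨⟨0, hn⟩, Finset.mem_univ _⟩
  have h := ((ConvexOn.log_sum hne hlog fun j x => by have := hp j; positivity).smul
    (show 0 ≤ 1 / (m * θ) by positivity)).neg
  refine h.congr fun x _ => ?_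
  simp only [Pi.neg_apply, smul_eq_mul]
  ring
end

section
/- Let H_A, H_B > 0, P_tot > 0, Ω ≥ 0, m ≥ 100, 0 ≤ q ≤ 9.9, θ > 0 and ε ∈ (0, 1/2]. Let x* ∈ (0, P_tot) be the unique maximizer of the full-duplex two-way relay SINR function γ on [0, P_tot], and suppose γ(x*) > 1. Then for every x ∈ [0, P_tot] with x ≠ x* and γ(x) > 1 one has h(r_{m,q}(γ(x))) < h(r_{m,q}(γ(x*))); i.e., the FD effective capacity x ↦ h(r_{m,q}(γ(x))) attains its maximum over {x ∈ [0, P_tot] : γ(x) > 1} uniquely at x*. -/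
noncomputable def gammaFD (HA HB Ptot Ω x : ℝ) : ℝ :=
  ((Ptot - x) / 2) * x * HA * HB /
    (x ^ 2 * HA * Ω + x * HA +
      (((Ptot - x) / 2) * Ω + 1) *
        (((Ptot - x) / 2) * HA + ((Ptot - x) / 2) * HB + x * Ω + 1))

noncomputable def hFD (m θ ε t : ℝ) : ℝ :=
  -(1 / (m * θ)) * Real.log (Real.exp (-(t * m * θ)) * (1 - ε) + ε)

theorem sq_sqrt_div_add_one {x : ℝ} (hx : 0 ≤ x) :
    (Real.sqrt (x * (x + 2)) / (x + 1)) ^ 2 = 1 - 1 / (x + 1) ^ 2 := by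
  rw [div_pow, Real.sq_sqrt (by positivity)]
  field_simp
  ring

theorem half_le_sqrt_div_add_one {x : ℝ} (hx : 1 ≤ x) :
    1 / 2 ≤ Real.sqrt (x * (x + 2)) / (x + 1) := by
  rw [le_div_iff₀ (by linarith)]
  exact Real.le_sqrt_of_sq_le (by nlinarith)

theorem sqrt_div_add_one_sub_lt_log_sub {a b : ℝ} (ha : 1 ≤ a) (hab : a < b) :
    Real.sqrt (b * (b + 2)) / (b + 1) - Real.sqrt (a * (a + 2)) / (a + 1) <
      Real.log (1 + b) - Real.log (1 + a) := by
  have hsa := sq_sqrt_div_add_one (x := a) (by linarith)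
  have hsb := sq_sqrt_div_add_one (x := b) (by linarith)
  have ha' := half_le_sqrt_div_add_one ha
  have hb' := half_le_sqrt_div_add_one (ha.trans hab.le)
  set s := Real.sqrt (a * (a + 2)) / (a + 1)
  set t := Real.sqrt (b * (b + 2)) / (b + 1)
  have hlog : 1 - (1 + a) / (1 + b) ≤ Real.log (1 + b) - Real.log (1 + a) := by
    have h := Real.log_le_sub_one_of_pos (x := (1 + a) / (1 + b))
      (div_pos (by linarith) (by linarith))
    rw [Real.log_div (by linarith) (by linarith)] at h
    linarith
  have hdiff : 1 / (a + 1) ^ 2 - 1 / (b + 1) ^ 2 < 1 - (1 + a) / (1 + b) := by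
    have hpos : 0 < (a + 1) ^ 2 * (b + 1) - (a + b + 2) := by
      nlinarith [mul_nonneg (sub_nonneg.2 ha) (show 0 ≤ (a + 3) * (b + 1) by nlinarith)]
    have h : 1 - (1 + a) / (1 + b) - (1 / (a + 1) ^ 2 - 1 / (b + 1) ^ 2) =
        (b - a) * ((a + 1) ^ 2 * (b + 1) - (a + b + 2)) / ((a + 1) ^ 2 * (b + 1) ^ 2) := by
      have h1 : a + 1 ≠ 0 := by linarith
      have h2 : b + 1 ≠ 0 := by linarith
      rw [add_comm 1 a, add_comm 1 b]
      field_simp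
      ring
    have h' : 0 < (b - a) * ((a + 1) ^ 2 * (b + 1) - (a + b + 2)) /
        ((a + 1) ^ 2 * (b + 1) ^ 2) :=
      div_pos (mul_pos (by linarith) hpos) (mul_pos (pow_pos (by linarith) 2)
        (pow_pos (by linarith) 2))
    linarith
  have hab2 : (a + 1) ^ 2 ≤ (b + 1) ^ 2 := by nlinarith
  have hinv : 1 / (b + 1) ^ 2 ≤ 1 / (a + 1) ^ 2 :=
    one_div_le_one_div_of_le (pow_pos (by linarith) 2) hab2
  have hst : s ≤ t := by nlinarith
  nlinarith [mul_nonneg (sub_nonneg.2 hst) (show 0 ≤ t + s - 1 by linarith)]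

theorem rFBL_strictMonoOn {m q : ℝ} (hm : 0 < m) (hq0 : 0 ≤ q) (hq : q ≤ Real.sqrt m) :
    StrictMonoOn (rFBL m q) (Set.Ici 1) := by
  intro a ha b hb hab
  rw [Set.mem_Ici] at ha hb
  have hsm : 0 < Real.sqrt m := Real.sqrt_pos.2 hm
  have key := sqrt_div_add_one_sub_lt_log_sub ha hab
  have hlog : 0 < Real.log (1 + b) - Real.log (1 + a) :=
    sub_pos.2 (Real.log_lt_log (by linarith) (by linarith))
  have hk0 : 0 ≤ q / Real.sqrt m := by positivity
  have hk1 : q / Real.sqrt m ≤ 1 := (div_le_one hsm).2 hq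
  have hl2 : 0 < Real.log 2 := Real.log_pos one_lt_two
  have hform (x : ℝ) : rFBL m q x =
      (Real.log (1 + x) - q / Real.sqrt m * (Real.sqrt (x * (x + 2)) / (x + 1))) / Real.log 2
        + Real.logb 2 m / m := by
    simp only [rFBL, Real.logb, Real.log_exp, div_eq_mul_inv, mul_inv]
    ring
  rw [hform, hform]
  gcongr ?_ / _ + _
  set s := Real.sqrt (a * (a + 2)) / (a + 1)
  set t := Real.sqrt (b * (b + 2)) / (b + 1)
  rcases le_total s t with h | h
  · nlinarith [mul_nonneg (sub_nonneg.2 h) (sub_nonneg.2 hk1)]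
  · nlinarith [mul_nonneg (sub_nonneg.2 h) hk0]

theorem hFD_strictMono {m θ ε : ℝ} (hm : 0 < m) (hθ : 0 < θ) (hε0 : 0 ≤ ε) (hε1 : ε < 1) :
    StrictMono (hFD m θ ε) := by
  intro s t hst
  have hε : 0 < 1 - ε := by linarith
  have hlog : Real.log (Real.exp (-(t * m * θ)) * (1 - ε) + ε) <
      Real.log (Real.exp (-(s * m * θ)) * (1 - ε) + ε) := by
    apply Real.log_lt_log (by positivity)
    gcongr
  have hc : 0 < 1 / (m * θ) := by positivity
  simp only [hFD]
  nlinarith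

theorem stmt_16 (HA HB Ptot Ω m q θ ε : ℝ) (hHA : 0 < HA) (hHB : 0 < HB) (hP : 0 < Ptot)
    (hΩ : 0 ≤ Ω) (hm : 100 ≤ m) (hq0 : 0 ≤ q) (hq1 : q ≤ 9.9) (hθ : 0 < θ)
    (hε0 : 0 < ε) (hε1 : ε ≤ 1 / 2)
    (xstar : ℝ) (hxstar : xstar ∈ Set.Ioo (0 : ℝ) Ptot)
    (hmax : ∀ x ∈ Set.Icc (0 : ℝ) Ptot, gammaFD HA HB Ptot Ω x ≤ gammaFD HA HB Ptot Ω xstar)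
    (huniq : ∀ y ∈ Set.Icc (0 : ℝ) Ptot,
      (∀ x ∈ Set.Icc (0 : ℝ) Ptot, gammaFD HA HB Ptot Ω x ≤ gammaFD HA HB Ptot Ω y) →
      y = xstar)
    (hgt : 1 < gammaFD HA HB Ptot Ω xstar) :
    ∀ x ∈ Set.Icc (0 : ℝ) Ptot, x ≠ xstar → 1 < gammaFD HA HB Ptot Ω x →
      hFD m θ ε (rFBL m q (gammaFD HA HB Ptot Ω x)) <
        hFD m θ ε (rFBL m q (gammaFD HA HB Ptot Ω xstar)) := by
  intro x hx hne hgx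
  have hlt : gammaFD HA HB Ptot Ω x < gammaFD HA HB Ptot Ω xstar := by
    refine lt_of_le_of_ne (hmax x hx) fun h ↦ hne (huniq x hx fun y hy ↦ ?_)
    rw [h]
    exact hmax y hy
  have hq : q ≤ Real.sqrt m := Real.le_sqrt_of_sq_le (by nlinarith)
  exact hFD_strictMono (by linarith) hθ hε0.le (by linarith)
    (rFBL_strictMonoOn (by linarith) hq0 hq hgx.le hgt.le hlt)
end
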